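/- Let δ > 1 and let μ_{V_δ}(dx) = C_δ e^{−(1+|x|^δ)} dx (i.e. V_δ(x) = 1 + |x|^δ). Then there exist positive constants c₁, c₂ such that the super Poincaré inequality μ_{V_δ}(f²) ≤ s · 𝓔_{α,V_δ}(f,f) + β(s) · μ_{V_δ}(|f|)² holds for all s > 0 and f ∈ C_b^∞(ℝ^d), with rate function β(s) = c₁ exp( c₂ (1 + log^{δ/(δ−1)}(1 + 1/s)) ). -/

import Mathlib

open MeasureTheory Real Set Metric Filter

noncomputable section

/-- Euclidean space `ℝ^d`. -/
abbrev Ed (d : ℕ) := EuclideanSpace ℝ (Fin d)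

/-- The probability measure `μ_V(dx) = C_V e^{-V(x)} dx` with `C_V = (∫ e^{-V})⁻¹`. -/
def muV (d : ℕ) (V : Ed d → ℝ) : Measure (Ed d) :=
  (volume : Measure (Ed d)).withDensity
    fun x => ENNReal.ofReal ((∫ y, Real.exp (-V y))⁻¹ * Real.exp (-V x))

/-- `f ∈ C_b^∞(ℝ^d)`: smooth with bounded derivatives of every order. -/
def CbSmooth (d : ℕ) (f : Ed d → ℝ) : Prop :=
  ContDiff ℝ (⊤ : ℕ∞) f ∧ ∀ n : ℕ, ∃ C : ℝ, ∀ x, ‖iteratedFDeriv ℝ n f x‖ ≤ C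

/-- `V` is locally bounded. -/
def LocallyBounded (d : ℕ) (V : Ed d → ℝ) : Prop :=
  ∀ r : ℝ, ∃ M : ℝ, ∀ x : Ed d, ‖x‖ ≤ r → |V x| ≤ M

/-- The nonlocal Dirichlet form with finite range jumps `𝓔_{α,V}`. -/
def formE (d : ℕ) (α : ℝ) (V f : Ed d → ℝ) : ℝ :=
  (1/2) * ∫ x, (∫ y in {y : Ed d | dist x y ≤ 1},
      (f x - f y) ^ 2 / dist x y ^ ((d : ℝ) + α)) ∂(muV d V)

/-- The nonlocal Dirichlet form with large jumps `𝓓_{α,V}`. -/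
def formD (d : ℕ) (α : ℝ) (V f : Ed d → ℝ) : ℝ :=
  (1/2) * ∫ x, (∫ y in {y : Ed d | 1 < dist x y},
      (f x - f y) ^ 2 / dist x y ^ ((d : ℝ) + α)) ∂(muV d V)

/-- `inf_{z : |x|-1 ≤ |z| ≤ |x|-1/2} e^{-V(z)}`. -/
def infAnn (d : ℕ) (V : Ed d → ℝ) (x : Ed d) : ℝ :=
  sInf ((fun z => Real.exp (-V z)) '' {z : Ed d | ‖x‖ - 1 ≤ ‖z‖ ∧ ‖z‖ ≤ ‖x‖ - 1/2})

/-- `sup_{z : |x| ≤ |z| ≤ |x|+1} e^{-V(z)}`. -/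
def supAnn (d : ℕ) (V : Ed d → ℝ) (x : Ed d) : ℝ :=
  sSup ((fun z => Real.exp (-V z)) '' {z : Ed d | ‖x‖ ≤ ‖z‖ ∧ ‖z‖ ≤ ‖x‖ + 1})

/-- `K(r) = sup_{|x| ≤ r} e^{-V(x)}`. -/
def Kfun (d : ℕ) (V : Ed d → ℝ) (r : ℝ) : ℝ :=
  sSup ((fun x => Real.exp (-V x)) '' {x : Ed d | ‖x‖ ≤ r})

/-- `k(r) = inf_{|x| ≤ r+1} e^{-V(x)}`. -/
def kfun (d : ℕ) (V : Ed d → ℝ) (r : ℝ) : ℝ :=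
  sInf ((fun x => Real.exp (-V x)) '' {x : Ed d | ‖x‖ ≤ r + 1})

/-- The constant `(1/α)·2^{2d+1}·(e + e^{1/2})·(2^α − 1)`. -/
def thresholdConst (d : ℕ) (α : ℝ) : ℝ :=
  (1/α) * (2:ℝ) ^ (2*d+1) * (Real.exp 1 + Real.exp (1/2)) * ((2:ℝ) ^ α - 1)

/-- `V_δ(x) = 1 + |x|^δ`. -/
def Vdelta (d : ℕ) (δ : ℝ) : Ed d → ℝ := fun x => 1 + ‖x‖ ^ δ

open scoped ENNReal

lemma lintegral_lintegral_closedBall_swap {d : ℕ} {G : Ed d → Ed d → ℝ≥0∞}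
    (hG : Measurable (Function.uncurry G)) (r : ℝ) :
    ∫⁻ x, ∫⁻ z in closedBall x r, G x z = ∫⁻ z, ∫⁻ x in closedBall z r, G x z := by
  have hS : MeasurableSet {p : Ed d × Ed d | dist p.2 p.1 ≤ r} :=
    measurableSet_le (by fun_prop) measurable_const
  have h1 : ∀ x, ∫⁻ z in closedBall x r, G x z
      = ∫⁻ z, {p : Ed d × Ed d | dist p.2 p.1 ≤ r}.indicator (Function.uncurry G) (x, z) := by
    intro x
    rw [← lintegral_indicator measurableSet_closedBall]
    rfl
  have h2 : ∀ z, ∫⁻ x in closedBall z r, G x z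
      = ∫⁻ x, {p : Ed d × Ed d | dist p.2 p.1 ≤ r}.indicator (Function.uncurry G) (x, z) := by
    intro z
    rw [← lintegral_indicator measurableSet_closedBall]
    congr 1 with x
    simp only [indicator, mem_closedBall, Set.mem_ofPred_eq, dist_comm x z, Function.uncurry]
  simp_rw [h1, h2]
  exact lintegral_lintegral_swap (hG.indicator hS).aemeasurable

lemma measurable_lintegral_closedBall {d : ℕ} {G : Ed d → Ed d → ℝ≥0∞}
    (hG : Measurable (Function.uncurry G)) (r : ℝ) :
    Measurable fun x => ∫⁻ z in closedBall x r, G x z := by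
  have hS : MeasurableSet {p : Ed d × Ed d | dist p.2 p.1 ≤ r} :=
    measurableSet_le (by fun_prop) measurable_const
  have h : (fun x => ∫⁻ z in closedBall x r, G x z) = fun x =>
      ∫⁻ z, {p : Ed d × Ed d | dist p.2 p.1 ≤ r}.indicator (Function.uncurry G) (x, z) := by
    ext x
    rw [← lintegral_indicator measurableSet_closedBall]
    rfl
  rw [h]
  exact (hG.indicator hS).lintegral_prod_right'

/-- The part of `∫ f² w` far from the origin is controlled through jumps of length at most one
towards the origin, along which the weight `w` increases by a factor `q⁻¹`. -/
lemma lintegral_sq_far_le {d : ℕ} {w : Ed d → ℝ≥0∞} (hw : Measurable w) {f : Ed d → ℝ}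
    (hf : Measurable f) {R : ℝ} (hR : 1 ≤ R) {q : ℝ≥0∞}
    (hq : ∀ x z, R ≤ ‖x‖ → ‖z‖ ≤ ‖x‖ - 1 / 2 → w x ≤ q * w z) :
    volume (closedBall (0 : Ed d) (1 / 4)) *
        ∫⁻ x in {x : Ed d | R ≤ ‖x‖}, w x * ENNReal.ofReal (f x ^ 2) ≤
      2 * q * (∫⁻ z, w z * ∫⁻ x in closedBall z 1, ENNReal.ofReal ((f z - f x) ^ 2)) +
      2 * q * volume (closedBall (0 : Ed d) 1) * ∫⁻ z, w z * ENNReal.ofReal (f z ^ 2) := by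
  set G : Ed d → Ed d → ℝ≥0∞ := fun x z =>
    2 * q * (w z * ENNReal.ofReal ((f z - f x) ^ 2)) + 2 * q * (w z * ENNReal.ofReal (f z ^ 2))
    with hGdef
  have hG : Measurable (Function.uncurry G) := by
    simp only [hGdef, Function.uncurry_def]
    fun_prop
  have hpt : ∀ x ∈ {x : Ed d | R ≤ ‖x‖}, volume (closedBall (0 : Ed d) (1 / 4)) *
      (w x * ENNReal.ofReal (f x ^ 2)) ≤ ∫⁻ z in closedBall x 1, G x z := by
    intro x hx
    have hx : R ≤ ‖x‖ := hx
    have hx0 : 0 < ‖x‖ := by linarith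
    set z₀ : Ed d := (1 - 3 / 4 * ‖x‖⁻¹) • x with hz₀
    have hn : ‖z₀‖ = ‖x‖ - 3 / 4 := by
      have h0 : 0 ≤ 1 - 3 / 4 * ‖x‖⁻¹ := by
        have : ‖x‖⁻¹ ≤ 1 := inv_le_one_of_one_le₀ (by linarith)
        linarith
      rw [hz₀, norm_smul, Real.norm_of_nonneg h0]
      field_simp
    have hdist : dist z₀ x = 3 / 4 := by
      have : z₀ - x = (-(3 / 4 * ‖x‖⁻¹)) • x := by rw [hz₀]; module
      rw [dist_eq_norm, this, norm_smul, norm_neg, Real.norm_of_nonneg (by positivity)]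
      field_simp
    have hsub : closedBall z₀ (1 / 4) ⊆ closedBall x 1 :=
      closedBall_subset_closedBall' (by rw [hdist]; norm_num)
    calc volume (closedBall (0 : Ed d) (1 / 4)) * (w x * ENNReal.ofReal (f x ^ 2))
        = ∫⁻ _ in closedBall z₀ (1 / 4), w x * ENNReal.ofReal (f x ^ 2) := by
          rw [setLIntegral_const, Measure.addHaar_closedBall_center volume z₀, mul_comm]
      _ ≤ ∫⁻ z in closedBall z₀ (1 / 4), G x z := by
          refine setLIntegral_mono' measurableSet_closedBall fun z hz => ?_
          have hz' : ‖z‖ ≤ ‖x‖ - 1 / 2 := by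
            have h1 : ‖z - z₀‖ ≤ 1 / 4 := by simpa [dist_eq_norm] using hz
            have h2 := norm_le_norm_add_norm_sub' z z₀
            linarith
          have h3 : ENNReal.ofReal (f x ^ 2) ≤
              2 * ENNReal.ofReal ((f z - f x) ^ 2) + 2 * ENNReal.ofReal (f z ^ 2) := by
            have e2 : (2 : ℝ≥0∞) = ENNReal.ofReal 2 := by simp
            rw [e2, ← ENNReal.ofReal_mul (by norm_num), ← ENNReal.ofReal_mul (by norm_num),
              ← ENNReal.ofReal_add (by positivity) (by positivity)]
            apply ENNReal.ofReal_le_ofReal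
            nlinarith [sq_nonneg (f x - 2 * f z)]
          calc w x * ENNReal.ofReal (f x ^ 2)
              ≤ (q * w z) * (2 * ENNReal.ofReal ((f z - f x) ^ 2)
                  + 2 * ENNReal.ofReal (f z ^ 2)) := by
                gcongr
                exact hq x z hx hz'
            _ = G x z := by simp only [hGdef]; ring
      _ ≤ ∫⁻ z in closedBall x 1, G x z := lintegral_mono_set hsub
  calc _ = ∫⁻ x in {x : Ed d | R ≤ ‖x‖}, volume (closedBall (0 : Ed d) (1 / 4)) *
          (w x * ENNReal.ofReal (f x ^ 2)) := (lintegral_const_mul _ (by fun_prop)).symm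
    _ ≤ ∫⁻ x in {x : Ed d | R ≤ ‖x‖}, ∫⁻ z in closedBall x 1, G x z :=
        setLIntegral_mono' (measurableSet_le measurable_const measurable_norm) hpt
    _ ≤ ∫⁻ x, ∫⁻ z in closedBall x 1, G x z := setLIntegral_le_lintegral _ _
    _ = ∫⁻ z, ∫⁻ x in closedBall z 1, G x z := lintegral_lintegral_closedBall_swap hG 1
    _ = ∫⁻ z, (2 * q * (w z * ∫⁻ x in closedBall z 1, ENNReal.ofReal ((f z - f x) ^ 2)) +
          2 * q * volume (closedBall (0 : Ed d) 1) * (w z * ENNReal.ofReal (f z ^ 2))) := by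
        congr 1 with z
        simp only [hGdef]
        rw [lintegral_add_right _ measurable_const, setLIntegral_const,
          Measure.addHaar_closedBall_center, lintegral_const_mul _ (by fun_prop),
          lintegral_const_mul _ (by fun_prop)]
        ring
    _ = _ := by
        have hJ : Measurable fun z =>
            w z * ∫⁻ x in closedBall z 1, ENNReal.ofReal ((f z - f x) ^ 2) :=
          hw.mul (measurable_lintegral_closedBall (by fun_prop) 1)
        rw [lintegral_add_right _ (by fun_prop), lintegral_const_mul _ (by fun_prop),
          lintegral_const_mul _ (by fun_prop)]

/-- Local super Poincaré inequality at scale `r`. -/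
lemma lintegral_sq_near_le {d : ℕ} {w : Ed d → ℝ≥0∞} (hw : Measurable w) {f : Ed d → ℝ}
    (hf : Measurable f) {R r p : ℝ} (hr : r ≤ 1) (hr0 : 0 < r) (hp : 0 ≤ p) {M : ℝ≥0∞}
    (hM : ∀ z : Ed d, ‖z‖ ≤ R + 1 → 1 ≤ M * w z) :
    volume (closedBall (0 : Ed d) r) *
        ∫⁻ x in {x : Ed d | R ≤ ‖x‖}ᶜ, w x * ENNReal.ofReal (f x ^ 2) ≤
      ENNReal.ofReal (r ^ p) *
        (∫⁻ x, w x * ∫⁻ z in closedBall x 1, ENNReal.ofReal ((f x - f z) ^ 2 / dist x z ^ p)) +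
      2 * M * (∫⁻ x, w x * ENNReal.ofReal |f x|) ^ 2 := by
  set m : ℝ≥0∞ := ∫⁻ x, w x * ENNReal.ofReal |f x| with hm
  have hpt : ∀ x ∈ {x : Ed d | R ≤ ‖x‖}ᶜ, volume (closedBall (0 : Ed d) r) *
      (w x * ENNReal.ofReal (f x ^ 2)) ≤ ENNReal.ofReal (r ^ p) *
        (w x * ∫⁻ z in closedBall x 1, ENNReal.ofReal ((f x - f z) ^ 2 / dist x z ^ p)) +
        2 * M * m * (w x * ENNReal.ofReal |f x|) := by
    intro x hx
    have hx : ‖x‖ < R := by simpa using hx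
    have hzm : ∫⁻ z in closedBall x r, ENNReal.ofReal |f z| ≤ M * m := by
      calc ∫⁻ z in closedBall x r, ENNReal.ofReal |f z|
          ≤ ∫⁻ z in closedBall x r, M * (w z * ENNReal.ofReal |f z|) := by
            refine setLIntegral_mono' measurableSet_closedBall fun z hz => ?_
            have h1 : ‖z - x‖ ≤ r := by simpa [dist_eq_norm] using hz
            have h2 := norm_le_norm_add_norm_sub' z x
            rw [← mul_assoc]
            exact le_mul_of_one_le_left' (hM z (by linarith))
        _ ≤ ∫⁻ z, M * (w z * ENNReal.ofReal |f z|) := setLIntegral_le_lintegral _ _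
        _ = M * m := lintegral_const_mul _ (by fun_prop)
    have hd2 : ∫⁻ z in closedBall x r, ENNReal.ofReal ((f x - f z) ^ 2) ≤ ENNReal.ofReal (r ^ p) *
        ∫⁻ z in closedBall x 1, ENNReal.ofReal ((f x - f z) ^ 2 / dist x z ^ p) := by
      calc _ ≤ ∫⁻ z in closedBall x r, ENNReal.ofReal (r ^ p) *
            ENNReal.ofReal ((f x - f z) ^ 2 / dist x z ^ p) := by
            refine setLIntegral_mono' measurableSet_closedBall fun z hz => ?_
            rw [← ENNReal.ofReal_mul (by positivity)]
            apply ENNReal.ofReal_le_ofReal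
            rcases eq_or_ne x z with rfl | hne
            · simp
            have h0 : 0 < dist x z := dist_pos.2 hne
            have h1 : dist x z ^ p ≤ r ^ p :=
              Real.rpow_le_rpow h0.le (by rw [dist_comm]; exact hz) hp
            have h2 : 0 < dist x z ^ p := Real.rpow_pos_of_pos h0 _
            rw [← mul_div_assoc, le_div_iff₀ h2, mul_comm]
            gcongr
        _ = ENNReal.ofReal (r ^ p) *
            ∫⁻ z in closedBall x r, ENNReal.ofReal ((f x - f z) ^ 2 / dist x z ^ p) :=
            lintegral_const_mul _ (by fun_prop)
        _ ≤ _ := by gcongr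
    calc volume (closedBall (0 : Ed d) r) * (w x * ENNReal.ofReal (f x ^ 2))
        = w x * ∫⁻ _ in closedBall x r, ENNReal.ofReal (f x ^ 2) := by
          rw [setLIntegral_const, Measure.addHaar_closedBall_center volume x]
          ring
      _ ≤ w x * ∫⁻ z in closedBall x r, (ENNReal.ofReal ((f x - f z) ^ 2) +
            2 * ENNReal.ofReal |f x| * ENNReal.ofReal |f z|) := by
          gcongr with z
          have e2 : (2 : ℝ≥0∞) = ENNReal.ofReal 2 := by simp
          rw [e2, ← ENNReal.ofReal_mul (by norm_num), ← ENNReal.ofReal_mul (by positivity),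
            ← ENNReal.ofReal_add (by positivity) (by positivity)]
          apply ENNReal.ofReal_le_ofReal
          have := le_abs_self (f x * f z)
          rw [abs_mul] at this
          nlinarith [sq_nonneg (f z)]
      _ = w x * ((∫⁻ z in closedBall x r, ENNReal.ofReal ((f x - f z) ^ 2)) +
            2 * ENNReal.ofReal |f x| * ∫⁻ z in closedBall x r, ENNReal.ofReal |f z|) := by
          rw [lintegral_add_right _ (by fun_prop), lintegral_const_mul _ (by fun_prop)]
      _ ≤ w x * (ENNReal.ofReal (r ^ p) *
            (∫⁻ z in closedBall x 1, ENNReal.ofReal ((f x - f z) ^ 2 / dist x z ^ p)) +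
            2 * ENNReal.ofReal |f x| * (M * m)) := by gcongr
      _ = _ := by ring
  calc _ = ∫⁻ x in {x : Ed d | R ≤ ‖x‖}ᶜ, volume (closedBall (0 : Ed d) r) *
          (w x * ENNReal.ofReal (f x ^ 2)) := (lintegral_const_mul _ (by fun_prop)).symm
    _ ≤ ∫⁻ x in {x : Ed d | R ≤ ‖x‖}ᶜ, (ENNReal.ofReal (r ^ p) *
        (w x * ∫⁻ z in closedBall x 1, ENNReal.ofReal ((f x - f z) ^ 2 / dist x z ^ p)) +
        2 * M * m * (w x * ENNReal.ofReal |f x|)) :=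
        setLIntegral_mono' (measurableSet_le measurable_const measurable_norm).compl hpt
    _ ≤ ∫⁻ x, (ENNReal.ofReal (r ^ p) *
        (w x * ∫⁻ z in closedBall x 1, ENNReal.ofReal ((f x - f z) ^ 2 / dist x z ^ p)) +
        2 * M * m * (w x * ENNReal.ofReal |f x|)) := setLIntegral_le_lintegral _ _
    _ = _ := by
        rw [lintegral_add_right _ (by fun_prop), lintegral_const_mul' _ _ ENNReal.ofReal_ne_top,
          lintegral_const_mul _ (by fun_prop), ← hm]
        ring

lemma isFiniteMeasure_muV (d : ℕ) (V : Ed d → ℝ) : IsFiniteMeasure (muV d V) := by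
  refine isFiniteMeasure_withDensity_ofReal (Integrable.hasFiniteIntegral ?_)
  by_cases h : Integrable fun x => Real.exp (-V x)
  · exact h.const_mul _
  · simp [integral_undef h]

lemma lintegral_muV {d : ℕ} {V : Ed d → ℝ} (hV : Measurable V) (g : Ed d → ℝ≥0∞) :
    ∫⁻ x, g x ∂muV d V =
      ∫⁻ x, ENNReal.ofReal ((∫ y, Real.exp (-V y))⁻¹ * Real.exp (-V x)) * g x := by
  rw [muV, lintegral_withDensity_eq_lintegral_mul_non_measurable _ (by fun_prop)
    (Filter.Eventually.of_forall fun _ => ENNReal.ofReal_lt_top)]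
  rfl

lemma CbSmooth.exists_bound {d : ℕ} {f : Ed d → ℝ} (hf : CbSmooth d f) :
    ∃ C, ∀ x, |f x| ≤ C := by
  obtain ⟨C, hC⟩ := hf.2 0
  exact ⟨C, fun x => by simpa using hC x⟩

lemma CbSmooth.exists_lipschitz {d : ℕ} {f : Ed d → ℝ} (hf : CbSmooth d f) :
    ∃ C, ∀ x y, |f x - f y| ≤ C * dist x y := by
  obtain ⟨C, hC⟩ := hf.2 1
  refine ⟨C, fun x y => ?_⟩
  rw [dist_eq_norm]
  exact convex_univ.norm_image_sub_le_of_norm_fderiv_le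
    (fun x _ => (hf.1.differentiable (by simp)).differentiableAt)
    (fun x _ => by simpa [norm_iteratedFDeriv_one] using hC x) (mem_univ y) (mem_univ x)

lemma lintegral_closedBall_dist_rpow_lt_top {d : ℕ} (hd : 1 ≤ d) {p : ℝ} (hp : -d < p) :
    ∫⁻ z in closedBall (0 : Ed d) 1, ENNReal.ofReal (‖z‖ ^ p) < ∞ := by
  have : Nonempty (Fin d) := ⟨⟨0, hd⟩⟩
  have h : IntegrableOn (fun z : Ed d => ‖z‖ ^ p) (ball 0 2) := by
    rw [integrableOn_fun_norm_addHaar volume (f := fun t : ℝ => t ^ p)]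
    have h1 : IntegrableOn (fun t : ℝ => t ^ ((d : ℝ) - 1 + p)) (Ioo 0 2) :=
      (intervalIntegral.integrableOn_Ioo_rpow_iff (by norm_num)).2 (by linarith)
    refine h1.congr_fun (fun t ht => ?_) measurableSet_Ioo
    have e : ((d - 1 : ℕ) : ℝ) = (d : ℝ) - 1 := by push_cast [hd]; ring
    simp only [finrank_euclideanSpace, Fintype.card_fin, smul_eq_mul]
    rw [← Real.rpow_natCast, e, ← Real.rpow_add ht.1]
  have h2 := (h.mono_set (closedBall_subset_ball (by norm_num : (1 : ℝ) < 2))).lintegral_lt_top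
  exact h2

lemma CbSmooth.exists_lintegral_le {d : ℕ} (hd : 1 ≤ d) {α : ℝ} (hα : α < 2)
    {f : Ed d → ℝ} (hf : CbSmooth d f) :
    ∃ C : ℝ≥0∞, C < ∞ ∧ ∀ x, ∫⁻ z in closedBall x 1,
      ENNReal.ofReal ((f x - f z) ^ 2 / dist x z ^ ((d : ℝ) + α)) ≤ C := by
  obtain ⟨C, hC⟩ := hf.exists_lipschitz
  set g : Ed d → ℝ≥0∞ := (closedBall (0 : Ed d) 1).indicator
    fun z => ENNReal.ofReal (‖z‖ ^ (2 - d - α)) with hg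
  refine ⟨ENNReal.ofReal (C ^ 2) *
    ∫⁻ z in closedBall (0 : Ed d) 1, ENNReal.ofReal (‖z‖ ^ (2 - d - α)),
    ENNReal.mul_lt_top ENNReal.ofReal_lt_top
      (lintegral_closedBall_dist_rpow_lt_top hd (by linarith)), fun x => ?_⟩
  calc _ ≤ ∫⁻ z in closedBall x 1, ENNReal.ofReal (C ^ 2) *
        ENNReal.ofReal (‖z - x‖ ^ (2 - d - α)) := by
        refine setLIntegral_mono' measurableSet_closedBall fun z _ => ?_
        rw [← ENNReal.ofReal_mul (by positivity)]
        apply ENNReal.ofReal_le_ofReal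
        rcases eq_or_ne x z with rfl | hne
        · simp only [sub_self, norm_zero, ne_eq, OfNat.ofNat_ne_zero, not_false_eq_true, zero_pow,
            zero_div]
          positivity
        have h0 : 0 < dist x z := dist_pos.2 hne
        rw [← dist_eq_norm, dist_comm z x, show (2 - d - α : ℝ) = 2 - (d + α) by ring,
          Real.rpow_sub h0, ← mul_div_assoc, Real.rpow_two, ← mul_pow]
        gcongr ?_ / _
        rw [← sq_abs (f x - f z)]
        gcongr
        exact hC x z
    _ = ENNReal.ofReal (C ^ 2) * ∫⁻ z, g (z - x) := by
        rw [lintegral_const_mul _ (by fun_prop), ← lintegral_indicator measurableSet_closedBall]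
        congr 2 with z
        simp [hg, indicator, dist_eq_norm]
    _ = _ := by
        rw [lintegral_sub_right_eq_self g x, hg, lintegral_indicator measurableSet_closedBall]

lemma lintegral_kernel_eq_ofReal_formE {d : ℕ} (hd : 1 ≤ d) {α : ℝ} (hα : α < 2)
    {V : Ed d → ℝ} (hV : Measurable V) {f : Ed d → ℝ} (hf : CbSmooth d f) :
    ∫⁻ x, ENNReal.ofReal ((∫ y, Real.exp (-V y))⁻¹ * Real.exp (-V x)) * ∫⁻ z in closedBall x 1,
      ENNReal.ofReal ((f x - f z) ^ 2 / dist x z ^ ((d : ℝ) + α)) =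
        ENNReal.ofReal (2 * formE d α V f) := by
  have := isFiniteMeasure_muV d V
  have hfm : Measurable f := hf.1.continuous.measurable
  obtain ⟨C, hCtop, hC⟩ := hf.exists_lintegral_le hd hα
  have hm : Measurable fun x => ∫⁻ z in closedBall x 1,
      ENNReal.ofReal ((f x - f z) ^ 2 / dist x z ^ ((d : ℝ) + α)) :=
    measurable_lintegral_closedBall (by fun_prop) 1
  have hin : ∀ x, ∫ y in {y : Ed d | dist x y ≤ 1}, (f x - f y) ^ 2 / dist x y ^ ((d : ℝ) + α) =
      (∫⁻ z in closedBall x 1,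
        ENNReal.ofReal ((f x - f z) ^ 2 / dist x z ^ ((d : ℝ) + α))).toReal := by
    intro x
    have hset : {y : Ed d | dist x y ≤ 1} = closedBall x 1 := by
      ext y
      simp [dist_comm]
    rw [hset, integral_eq_lintegral_of_nonneg_ae
      (Filter.Eventually.of_forall fun z => by dsimp; positivity)
      (Measurable.aestronglyMeasurable (by fun_prop))]
  rw [← lintegral_muV hV, formE, ← mul_assoc]
  simp_rw [hin]
  rw [integral_toReal hm.aemeasurable (Filter.Eventually.of_forall fun x => (hC x).trans_lt hCtop)]
  norm_num
  rw [ENNReal.ofReal_toReal]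
  refine ((lintegral_mono hC).trans_lt ?_).ne
  rw [lintegral_const]
  exact ENNReal.mul_lt_top hCtop (measure_lt_top _ _)

lemma integral_sq_muV_le {d : ℕ} (hd : 1 ≤ d) {α : ℝ} (hα : 0 < α ∧ α < 2)
    {V : Ed d → ℝ} (hV : Measurable V) (hZ : 0 < ∫ y, Real.exp (-V y))
    {f : Ed d → ℝ} (hf : CbSmooth d f) {R r q M : ℝ} (hR : 1 ≤ R) (hr0 : 0 < r) (hr : r ≤ 1)
    (hq0 : 0 ≤ q)
    (hq : ∀ x z, R ≤ ‖x‖ → ‖z‖ ≤ ‖x‖ - 1 / 2 → Real.exp (-V x) ≤ q * Real.exp (-V z))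
    (hq1 : 4 ^ d * q ≤ 1 / 4) (hM0 : 0 ≤ M)
    (hM : ∀ z : Ed d, ‖z‖ ≤ R + 1 → ∫ y, Real.exp (-V y) ≤ M * Real.exp (-V z)) :
    ∫ x, (f x) ^ 2 ∂(muV d V) ≤
      ((8 * 4 ^ d * q + 4 * r ^ α) / volume.real (closedBall (0 : Ed d) 1)) * formE d α V f +
        4 * M / (volume.real (closedBall (0 : Ed d) 1) * r ^ d) *
          (∫ x, |f x| ∂(muV d V)) ^ 2 := by
  have := isFiniteMeasure_muV d V
  have hfm : Measurable f := hf.1.continuous.measurable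
  obtain ⟨B, hB⟩ := hf.exists_bound
  set Z := ∫ y, Real.exp (-V y) with hZdef
  set w : Ed d → ℝ≥0∞ := fun x => ENNReal.ofReal (Z⁻¹ * Real.exp (-V x)) with hw
  have hwm : Measurable w := by fun_prop
  set v := volume.real (closedBall (0 : Ed d) 1) with hv
  have hv0 : 0 < v := ENNReal.toReal_pos (measure_closedBall_pos _ _ one_pos).ne'
    measure_closedBall_lt_top.ne
  have hvol : ∀ t : ℝ, 0 ≤ t → volume (closedBall (0 : Ed d) t) = ENNReal.ofReal (t ^ d * v) := by
    intro t ht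
    rw [Measure.addHaar_closedBall' _ _ ht, finrank_euclideanSpace, Fintype.card_fin,
      ENNReal.ofReal_mul (by positivity), hv, ofReal_measureReal measure_closedBall_lt_top.ne]
  set A := ∫ x, (f x) ^ 2 ∂(muV d V) with hA
  set m := ∫ x, |f x| ∂(muV d V) with hm
  set E := formE d α V f with hE
  have hA0 : 0 ≤ A := integral_nonneg fun x => sq_nonneg _
  have hm0 : 0 ≤ m := integral_nonneg fun x => abs_nonneg _
  have hE0 : 0 ≤ E := by
    rw [hE, formE]
    refine mul_nonneg (by norm_num) (integral_nonneg fun x => integral_nonneg fun y => ?_)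
    dsimp
    positivity
  have hAe : ∫⁻ x, w x * ENNReal.ofReal (f x ^ 2) = ENNReal.ofReal A := by
    rw [hA, ofReal_integral_eq_lintegral_ofReal _
      (Filter.Eventually.of_forall fun x => sq_nonneg _), lintegral_muV hV]
    refine Integrable.of_bound (by fun_prop) (B ^ 2) (Filter.Eventually.of_forall fun x => ?_)
    rw [Real.norm_of_nonneg (sq_nonneg _), ← sq_abs]
    gcongr
    exact hB x
  have hme : ∫⁻ x, w x * ENNReal.ofReal |f x| = ENNReal.ofReal m := by
    rw [hm, ofReal_integral_eq_lintegral_ofReal _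
      (Filter.Eventually.of_forall fun x => abs_nonneg _), lintegral_muV hV]
    refine Integrable.of_bound (by fun_prop) B (Filter.Eventually.of_forall fun x => ?_)
    rw [Real.norm_of_nonneg (abs_nonneg _)]
    exact hB x
  have hEe := lintegral_kernel_eq_ofReal_formE hd hα.2 hV hf
  have hE1 : ∫⁻ z, w z * ∫⁻ x in closedBall z 1, ENNReal.ofReal ((f z - f x) ^ 2) ≤
      ENNReal.ofReal (2 * E) := by
    rw [← hEe]
    refine lintegral_mono fun z => mul_le_mul_right (setLIntegral_mono'
      measurableSet_closedBall fun x hx => ENNReal.ofReal_le_ofReal ?_) _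
    rcases eq_or_ne z x with rfl | hne
    · simp
    have h0 : 0 < dist z x := dist_pos.2 hne
    refine le_div_self (sq_nonneg _) (Real.rpow_pos_of_pos h0 _) (Real.rpow_le_one h0.le ?_ ?_)
    · rw [dist_comm]
      exact hx
    · linarith [hα.1, (Nat.cast_nonneg d : (0 : ℝ) ≤ d)]
  have hS : MeasurableSet {x : Ed d | R ≤ ‖x‖} := measurableSet_le measurable_const measurable_norm
  have hsplit := lintegral_add_compl (μ := volume)
    (fun x => w x * ENNReal.ofReal (f x ^ 2)) hS
  rw [hAe] at hsplit
  have hfar := lintegral_sq_far_le hwm hfm hR (q := ENNReal.ofReal q) (fun x z hx hz => by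
    rw [hw, ← ENNReal.ofReal_mul hq0]
    apply ENNReal.ofReal_le_ofReal
    calc Z⁻¹ * Real.exp (-V x) ≤ Z⁻¹ * (q * Real.exp (-V z)) := by
          gcongr
          exact hq x z hx hz
      _ = _ := by ring)
  have hnear := lintegral_sq_near_le hwm hfm hr hr0 (R := R) (p := d + α)
    (M := ENNReal.ofReal M) (by linarith [hα.1, (Nat.cast_nonneg d : (0 : ℝ) ≤ d)]) (fun z hz => by
      rw [hw, ← ENNReal.ofReal_mul hM0, ← ENNReal.ofReal_one]
      apply ENNReal.ofReal_le_ofReal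
      rw [← mul_assoc, mul_comm M, mul_assoc, ← div_eq_inv_mul, one_le_div hZ]
      exact hM z hz)
  rw [hEe, hme] at hnear
  rw [hAe] at hfar
  set F := ∫⁻ x in {x : Ed d | R ≤ ‖x‖}, w x * ENNReal.ofReal (f x ^ 2)
  set N := ∫⁻ x in {x : Ed d | R ≤ ‖x‖}ᶜ, w x * ENNReal.ofReal (f x ^ 2)
  have hFt : F ≠ ∞ := ne_top_of_le_ne_top ENNReal.ofReal_ne_top (hsplit ▸ le_self_add)
  have hNt : N ≠ ∞ := ne_top_of_le_ne_top ENNReal.ofReal_ne_top (hsplit ▸ le_add_self)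
  have hAFN : A = F.toReal + N.toReal := by
    rw [← ENNReal.toReal_add hFt hNt, hsplit, ENNReal.toReal_ofReal hA0]
  have e2 : (2 : ℝ≥0∞) = ENNReal.ofReal 2 := by simp
  have hfar' : (1 / 4) ^ d * v * F.toReal ≤ 2 * q * (2 * E) + 2 * q * v * A := by
    have h := hfar.trans (add_le_add_left (mul_le_mul_right hE1 _) _)
    rw [hvol _ (by norm_num), hvol 1 zero_le_one, ← ENNReal.ofReal_toReal hFt, e2,
      ← ENNReal.ofReal_mul (by positivity), ← ENNReal.ofReal_mul (by positivity),
      ← ENNReal.ofReal_mul (by positivity), ← ENNReal.ofReal_mul (by positivity),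
      ← ENNReal.ofReal_mul (by positivity), ← ENNReal.ofReal_add (by positivity) (by positivity),
      ENNReal.ofReal_le_ofReal_iff (by positivity), one_pow, one_mul] at h
    exact h
  have hnear' : r ^ d * v * N.toReal ≤ r ^ ((d : ℝ) + α) * (2 * E) + 2 * M * m ^ 2 := by
    have h := hnear
    rw [hvol _ hr0.le, ← ENNReal.ofReal_toReal hNt, e2,
      ← ENNReal.ofReal_pow (by positivity), ← ENNReal.ofReal_mul (by positivity),
      ← ENNReal.ofReal_mul (by positivity),
      ← ENNReal.ofReal_mul (by positivity), ← ENNReal.ofReal_mul (by positivity),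
      ← ENNReal.ofReal_add (by positivity) (by positivity),
      ENNReal.ofReal_le_ofReal_iff (by positivity)] at h
    exact h
  have hF2 : F.toReal ≤ 4 * 4 ^ d * q / v * E + A / 2 := by
    have h4 : (4 : ℝ) ^ d * (1 / 4) ^ d = 1 := by rw [← mul_pow]; norm_num
    calc F.toReal = (4 : ℝ) ^ d / v * ((1 / 4) ^ d * v * F.toReal) := by
          field_simp
          linear_combination (-F.toReal) * h4
      _ ≤ (4 : ℝ) ^ d / v * (2 * q * (2 * E) + 2 * q * v * A) := by gcongr
      _ = 4 * 4 ^ d * q / v * E + 2 * (4 ^ d * q) * A := by field_simp; ring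
      _ ≤ 4 * 4 ^ d * q / v * E + 2 * (1 / 4) * A := by gcongr
      _ = _ := by ring
  have hN2 : N.toReal ≤ 2 * r ^ α / v * E + 2 * M / (v * r ^ d) * m ^ 2 := by
    have hrd : 0 < r ^ d := pow_pos hr0 d
    rw [Real.rpow_add hr0, Real.rpow_natCast] at hnear'
    calc N.toReal = (r ^ d * v * N.toReal) / (r ^ d * v) := by field_simp
      _ ≤ (r ^ d * r ^ α * (2 * E) + 2 * M * m ^ 2) / (r ^ d * v) := by gcongr
      _ = _ := by field_simp
  have h1 : (8 * 4 ^ d * q + 4 * r ^ α) / v * E + 4 * M / (v * r ^ d) * m ^ 2 =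
      2 * (4 * 4 ^ d * q / v * E + (2 * r ^ α / v * E + 2 * M / (v * r ^ d) * m ^ 2)) := by
    ring
  linarith

lemma rpow_sub_half_add_le {δ : ℝ} (hδ : 1 < δ) {R s t : ℝ} (hR : 1 ≤ R) (hs : R ≤ s)
    (ht0 : 0 ≤ t) (ht : t ≤ s - 1 / 2) : t ^ δ + R ^ (δ - 1) / 2 ≤ s ^ δ := by
  have hmul : ∀ u : ℝ, 0 ≤ u → u ^ δ = u ^ (δ - 1) * u := by
    intro u hu
    rw [← Real.rpow_add_one' hu (by linarith), sub_add_cancel]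
  have h1 : t ^ (δ - 1) ≤ s ^ (δ - 1) := Real.rpow_le_rpow ht0 (by linarith) (by linarith)
  have h2 : R ^ (δ - 1) ≤ s ^ (δ - 1) := Real.rpow_le_rpow (by linarith) hs (by linarith)
  rw [hmul t ht0, hmul s (by linarith)]
  have h0 : 0 ≤ s ^ (δ - 1) := Real.rpow_nonneg (by linarith) _
  have h3 : t ^ (δ - 1) * t ≤ s ^ (δ - 1) * (s - 1 / 2) := by gcongr
  linarith

/-- super Poincaré inequality for `μ_{V_δ}(dx) = C_δ e^{-(1+|x|^δ)} dx`
with `δ > 1`, with rate function `β(s) = c₁ exp(c₂(1 + log^{δ/(δ-1)}(1+1/s)))`. -/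
theorem super_poincare_Vdelta
    (d : ℕ) (hd : 1 ≤ d) (α : ℝ) (hα : 0 < α ∧ α < 2)
    (δ : ℝ) (hδ : 1 < δ) :
    ∃ c₁ c₂ : ℝ, 0 < c₁ ∧ 0 < c₂ ∧ ∀ s : ℝ, 0 < s → ∀ f : Ed d → ℝ, CbSmooth d f →
      ∫ x, (f x) ^ 2 ∂(muV d (Vdelta d δ)) ≤ s * formE d α (Vdelta d δ) f +
        (c₁ * Real.exp (c₂ * (1 + Real.log (1 + 1/s) ^ (δ/(δ-1))))) *
        (∫ x, |f x| ∂(muV d (Vdelta d δ))) ^ 2 := by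
  obtain ⟨hα0, hα2⟩ := hα
  have hVm : Measurable (Vdelta d δ) := by unfold Vdelta; fun_prop
  have hZ0 : 0 ≤ ∫ y, Real.exp (-Vdelta d δ y) := integral_nonneg fun y => (Real.exp_pos _).le
  rcases hZ0.eq_or_lt with hZ | hZ
  · have hmu : muV d (Vdelta d δ) = 0 := by simp [muV, ← hZ]
    refine ⟨1, 1, one_pos, one_pos, fun s hs f hf => ?_⟩
    simp [hmu, formE]
  set Z := ∫ y, Real.exp (-Vdelta d δ y) with hZdef
  set v := volume.real (closedBall (0 : Ed d) 1) with hv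
  have hv0 : 0 < v := ENNReal.toReal_pos (measure_closedBall_pos _ _ one_pos).ne'
    measure_closedBall_lt_top.ne
  obtain ⟨K, hK1, hKa, hKb⟩ : ∃ K : ℝ, 1 ≤ K ∧ 4 ^ d * Real.exp (-K) ≤ 1 / 4 ∧
      (8 * 4 ^ d + 4) / v * Real.exp (-K) ≤ 1 := by
    have ha : Tendsto (fun K : ℝ => (4 : ℝ) ^ d * Real.exp (-K)) atTop (nhds 0) := by
      simpa using Real.tendsto_exp_neg_atTop_nhds_zero.const_mul ((4 : ℝ) ^ d)
    have hb : Tendsto (fun K : ℝ => (8 * 4 ^ d + 4) / v * Real.exp (-K)) atTop (nhds 0) := by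
      simpa using Real.tendsto_exp_neg_atTop_nhds_zero.const_mul ((8 * 4 ^ d + 4) / v)
    exact ((eventually_ge_atTop 1).and
      ((ha.eventually_le_const (by norm_num)).and (hb.eventually_le_const (by norm_num)))).exists
  have hδ1 : 0 < δ - 1 := by linarith
  set p := δ / (δ - 1) with hp
  have hp1 : 1 ≤ p := by rw [hp, le_div_iff₀ hδ1]; linarith
  refine ⟨4 * Z / v, 1 + 2 ^ δ * 2 ^ p * (K + 1) ^ p + d / α * (K + 1) ^ p, by positivity,
    by positivity, fun s hs f hf => ?_⟩
  set L := Real.log (1 + 1 / s) with hL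
  have hL0 : 0 ≤ L := Real.log_nonneg (le_add_of_nonneg_right (by positivity))
  have hexpL : Real.exp (-L) ≤ s := by
    rw [Real.exp_neg, hL, Real.exp_log (by positivity)]
    apply inv_le_of_inv_le₀ hs
    rw [one_div]
    linarith
  set T := L + K with hT
  have hT1 : 1 ≤ T := by linarith
  have hTp : T ^ p ≤ (K + 1) ^ p * (1 + L ^ p) := by
    have h1 : T ≤ (K + 1) * max 1 L := by
      have := le_max_left 1 L
      have := le_max_right 1 L
      nlinarith
    calc T ^ p ≤ ((K + 1) * max 1 L) ^ p := Real.rpow_le_rpow (by linarith) h1 (by linarith)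
      _ = (K + 1) ^ p * (max 1 L) ^ p := Real.mul_rpow (by linarith) (by positivity)
      _ ≤ _ := by
        gcongr
        rcases max_choice 1 L with h | h <;> rw [h]
        · rw [Real.one_rpow]
          linarith [Real.rpow_nonneg hL0 p]
        · linarith
  set R := (2 * T) ^ (1 / (δ - 1)) with hR
  have hR1 : 1 ≤ R := Real.one_le_rpow (by linarith) (by positivity)
  have hRδ1 : R ^ (δ - 1) = 2 * T := by
    rw [hR, ← Real.rpow_mul (by linarith), one_div_mul_cancel hδ1.ne', Real.rpow_one]
  have hRδ : R ^ δ = (2 * T) ^ p := by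
    rw [hR, ← Real.rpow_mul (by linarith), hp, one_div_mul_eq_div]
  set r := Real.exp (-T / α) with hr
  have hrα : r ^ α = Real.exp (-T) := by
    rw [hr, ← Real.exp_mul, div_mul_cancel₀ _ hα0.ne']
  have hTexp : Real.exp (-T) = Real.exp (-L) * Real.exp (-K) := by
    rw [← Real.exp_add, hT]
    ring_nf
  have key := integral_sq_muV_le hd ⟨hα0, hα2⟩ hVm hZ hf (R := R) (r := r)
    (q := Real.exp (-T)) (M := Z * Real.exp (1 + (R + 1) ^ δ)) hR1 (Real.exp_pos _)
    (Real.exp_le_one_iff.2 (div_nonpos_of_nonpos_of_nonneg (by linarith) hα0.le))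
    (Real.exp_pos _).le
    (fun x z hx hz => by
      rw [← Real.exp_add, Real.exp_le_exp]
      have := rpow_sub_half_add_le hδ hR1 hx (norm_nonneg z) hz
      rw [hRδ1] at this
      simp only [Vdelta]
      linarith)
    ((mul_le_mul_of_nonneg_left (Real.exp_le_exp.2 (by linarith)) (by positivity)).trans hKa)
    (by positivity)
    (fun z hz => by
      rw [mul_assoc, ← Real.exp_add]
      refine le_mul_of_one_le_right hZ.le (Real.one_le_exp ?_)
      have : ‖z‖ ^ δ ≤ (R + 1) ^ δ := Real.rpow_le_rpow (norm_nonneg z) hz (by linarith)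
      simp only [Vdelta]
      linarith)
  have hE0 : 0 ≤ formE d α (Vdelta d δ) f := by
    refine mul_nonneg (by norm_num) (integral_nonneg fun x => integral_nonneg fun y => ?_)
    dsimp
    positivity
  refine key.trans (add_le_add (mul_le_mul_of_nonneg_right ?_ hE0)
    (mul_le_mul_of_nonneg_right ?_ (sq_nonneg _)))
  · rw [hrα, hTexp]
    calc _ = Real.exp (-L) * ((8 * 4 ^ d + 4) / v * Real.exp (-K)) := by ring
      _ ≤ Real.exp (-L) * 1 := by gcongr
      _ ≤ s := by linarith
  · have hrd : r ^ d = Real.exp (-(d / α * T)) := by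
      rw [hr, ← Real.exp_nat_mul]
      congr 1
      ring
    have hL1 : 1 ≤ 1 + L ^ p := by linarith [Real.rpow_nonneg hL0 p]
    have hTT : T ≤ T ^ p := Real.self_le_rpow_of_one_le hT1 hp1
    have hR1δ : (R + 1) ^ δ ≤ 2 ^ δ * 2 ^ p * T ^ p := by
      calc (R + 1) ^ δ ≤ (2 * R) ^ δ :=
            Real.rpow_le_rpow (by linarith) (by linarith) (by linarith)
        _ = _ := by
          rw [Real.mul_rpow (by norm_num) (by linarith), hRδ,
            Real.mul_rpow (by norm_num) (by linarith), mul_assoc]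
    calc 4 * (Z * Real.exp (1 + (R + 1) ^ δ)) / (v * r ^ d)
        = 4 * Z / v * Real.exp (1 + (R + 1) ^ δ + d / α * T) := by
          rw [hrd, Real.exp_neg, Real.exp_add (1 + (R + 1) ^ δ)]
          field_simp
      _ ≤ _ := by
          gcongr
          calc 1 + (R + 1) ^ δ + d / α * T
              ≤ (1 + L ^ p) + 2 ^ δ * 2 ^ p * ((K + 1) ^ p * (1 + L ^ p)) +
                d / α * ((K + 1) ^ p * (1 + L ^ p)) := by
                gcongr
                · exact hR1δ.trans (by gcongr)
                · exact hTT.trans hTp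
            _ = _ := by ring
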